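/- Let X be a complete thin metric space and let A, B be disjoint closed connected subsets of X. Then: (1) there is a compact set K ⊆ X such that every open set V with K ⊆ V and V ∩ (A ∪ B) = ∅ separates A and B; (2) this K intersects every closed connected subset of X which meets both A and B; (3) if X is moreover locally compact, then there is a compact set K' which separates A and B. -/

import Mathlib

/-- The uniform quasi-component of `y` in `Y`: the intersection of all subsets
`U ⊆ Y` containing `y` that are at positive distance from `Y \ U`. -/
def uniformQuasiComponent {X : Type*} [MetricSpace X] (Y : Set X) (y : X) : Set X :=
  ⋂₀ {U : Set X | U ⊆ Y ∧ y ∈ U ∧ ∃ ε > (0 : ℝ), ∀ u ∈ U, ∀ v ∈ Y \ U, ε ≤ dist u v}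

/-- A metric space is thin if for every closed subset `Y` and every `y ∈ Y` the
uniform quasi-component of `y` in `Y` is connected. -/
def IsThin (X : Type*) [MetricSpace X] : Prop :=
  ∀ Y : Set X, IsClosed Y → ∀ y ∈ Y, IsConnected (uniformQuasiComponent Y y)

/-- Two sets `P`, `Q` are separated if the closure of each misses the other. -/
def IsSeparatedPair {X : Type*} [TopologicalSpace X] (P Q : Set X) : Prop :=
  closure P ∩ Q = ∅ ∧ P ∩ closure Q = ∅

/-- `S` separates `A` and `B` if the complement of `S` is the union of two disjoint
separated sets, one containing `A` and the other containing `B`. -/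
def SeparatesSets {X : Type*} [TopologicalSpace X] (S A B : Set X) : Prop :=
  ∃ P Q : Set X, P ∪ Q = Sᶜ ∧ Disjoint P Q ∧ IsSeparatedPair P Q ∧ A ⊆ P ∧ B ⊆ Q

open Set Filter Topology

/-- A chain in a preconnected set: a finite subset `E` through which membership propagates from
`x` to `y` along steps of length less than `δ`. -/
theorem IsPreconnected.exists_finset_chain {X : Type*} [MetricSpace X] {C : Set X}
    (hC : IsPreconnected C) {δ : ℝ} (hδ : 0 < δ) {x y : X} (hx : x ∈ C) (hy : y ∈ C) :
    ∃ E : Finset X, (E : Set X) ⊆ C ∧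
      ∀ U : Set X, x ∈ U → (∀ u ∈ U, ∀ v ∈ E, dist u v < δ → v ∈ U) → y ∈ U := by
  classical
  refine hC.induction₂' (fun x y => ∃ E : Finset X, (E : Set X) ⊆ C ∧
      ∀ U : Set X, x ∈ U → (∀ u ∈ U, ∀ v ∈ E, dist u v < δ → v ∈ U) → y ∈ U) ?_ ?_ hx hy
  · intro x hx
    filter_upwards [self_mem_nhdsWithin, mem_nhdsWithin_of_mem_nhds (Metric.ball_mem_nhds x hδ)]
      with y hy hyx
    refine ⟨⟨{y}, by simpa using hy, fun U hxU h => h x hxU y (by simp) ?_⟩,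
      ⟨{x}, by simpa using hx, fun U hyU h => h y hyU x (by simp) ?_⟩⟩
    · rw [dist_comm]; exact hyx
    · exact hyx
  · rintro x y z - - - ⟨E, hE, h⟩ ⟨F, hF, k⟩
    refine ⟨E ∪ F, by simpa using ⟨hE, hF⟩, fun U hxU hU => ?_⟩
    exact k U (h U hxU fun u hu v hv => hU u hu v (by simp [hv]))
      fun u hu v hv => hU u hu v (by simp [hv])

theorem IsPreconnected.subset_of_gap {X : Type*} [MetricSpace X] {A Y U : Set X}
    (hA : IsPreconnected A) (hAY : A ⊆ Y) {ε : ℝ} (hε : 0 < ε)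
    (hU : ∀ u ∈ U, ∀ v ∈ Y \ U, ε ≤ dist u v) (hAU : (A ∩ U).Nonempty) : A ⊆ U := by
  obtain ⟨a, haA, haU⟩ := hAU
  intro b hb
  obtain ⟨E, hE, h⟩ := hA.exists_finset_chain hε haA hb
  refine h U haU fun u hu v hv huv => ?_
  by_contra hvU
  exact absurd (hU u hu v ⟨hAY (hE hv), hvU⟩) (not_le.2 huv)

theorem closure_disjoint_of_gap {X : Type*} [MetricSpace X] {U W : Set X} {ε : ℝ} (hε : 0 < ε)
    (h : ∀ u ∈ U, ∀ v ∈ W, ε ≤ dist u v) : closure U ∩ W = ∅ := by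
  refine eq_empty_of_forall_notMem ?_
  rintro x ⟨hx, hxW⟩
  obtain ⟨u, hu, hxu⟩ := Metric.mem_closure_iff.1 hx ε hε
  rw [dist_comm] at hxu
  exact absurd (h u hu x hxW) (not_le.2 hxu)

theorem isClosed_uniformQuasiComponent {X : Type*} [MetricSpace X] {Y : Set X} (hY : IsClosed Y)
    (y : X) : IsClosed (uniformQuasiComponent Y y) := by
  refine isClosed_sInter ?_
  rintro U ⟨hUY, -, ε, hε, h⟩
  refine isClosed_of_closure_subset fun x hx => ?_
  by_contra hxU
  have := closure_disjoint_of_gap hε h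
  exact this.subset ⟨hx, closure_minimal hUY hY hx, hxU⟩

theorem uniformQuasiComponent_subset {X : Type*} [MetricSpace X] {Y : Set X} {y : X}
    (hy : y ∈ Y) : uniformQuasiComponent Y y ⊆ Y :=
  sInter_subset_of_mem ⟨Subset.rfl, hy, 1, one_pos, by simp⟩

theorem mem_uniformQuasiComponent_self {X : Type*} [MetricSpace X] (Y : Set X) (y : X) :
    y ∈ uniformQuasiComponent Y y :=
  fun _ hU => hU.2.1

/-- `N` meets every closed connected set that meets both `A` and `B`. -/
def MeetsConnectors {X : Type*} [TopologicalSpace X] (N A B : Set X) : Prop :=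
  ∀ C : Set X, IsClosed C → IsConnected C → (C ∩ A).Nonempty → (C ∩ B).Nonempty →
    (N ∩ C).Nonempty

theorem IsThin.separatesSets_of_meetsConnectors {X : Type*} [MetricSpace X] (hthin : IsThin X)
    {A B K V : Set X} (hA : IsConnected A) (hB : IsConnected B) (hK : MeetsConnectors K A B)
    (hV : IsOpen V) (hKV : K ⊆ V) (hVAB : Disjoint V (A ∪ B)) : SeparatesSets V A B := by
  obtain ⟨a, ha⟩ := hA.nonempty
  obtain ⟨b, hb⟩ := hB.nonempty
  have hAV : A ⊆ Vᶜ := fun x hx hxV => disjoint_left.1 hVAB hxV (Or.inl hx)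
  have hBV : B ⊆ Vᶜ := fun x hx hxV => disjoint_left.1 hVAB hxV (Or.inr hx)
  have hbQ : b ∉ uniformQuasiComponent Vᶜ a := fun hbQ => by
    obtain ⟨x, hxK, hxQ⟩ := hK _ (isClosed_uniformQuasiComponent hV.isClosed_compl a)
      (hthin _ hV.isClosed_compl a (hAV ha)) ⟨a, mem_uniformQuasiComponent_self _ a, ha⟩
      ⟨b, hbQ, hb⟩
    exact uniformQuasiComponent_subset (hAV ha) hxQ (hKV hxK)
  simp only [uniformQuasiComponent, mem_sInter, not_forall] at hbQ
  obtain ⟨U, ⟨hUV, haU, ε, hε, h⟩, hbU⟩ := hbQ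
  refine ⟨U, Vᶜ \ U, union_sdiff_cancel hUV, disjoint_sdiff_right,
    ⟨closure_disjoint_of_gap hε h, ?_⟩, hA.isPreconnected.subset_of_gap hAV hε h ⟨a, ha, haU⟩,
    fun x hx => ⟨hBV hx, fun hxU => ?_⟩⟩
  · rw [inter_comm]
    exact closure_disjoint_of_gap hε fun u hu v hv => by rw [dist_comm]; exact h v hv u hu
  · exact hbU (hB.isPreconnected.subset_of_gap hBV hε h ⟨x, hx, hxU⟩ hb)

theorem eq_of_isPreconnected_of_isolated {X : Type*} [TopologicalSpace X] [T1Space X]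
    {Q W : Set X} (hQ : IsPreconnected Q) {p a : X} (hp : p ∈ Q) (ha : a ∈ Q) (hW : IsOpen W)
    (hpW : p ∈ W) (h : Q ∩ W ⊆ {p}) : a = p := by
  by_contra hne
  obtain ⟨x, hxQ, hxW, hxp⟩ := hQ W {p}ᶜ hW isOpen_compl_singleton
    (fun x _ => by
      by_cases hx : x = p
      · exact Or.inl (hx ▸ hpW)
      · exact Or.inr hx) ⟨p, hp, hpW⟩ ⟨a, ha, hne⟩
  exact hxp (h ⟨hxQ, hxW⟩)

/-- A union of finite sets whose points in different sets are uniformly far apart is discrete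
and closed. -/
theorem exists_isOpen_inter_iUnion_subset_singleton {X : Type*} [MetricSpace X]
    {E : ℕ → Set X} (hE : ∀ n, (E n).Finite) {ε : ℝ} (hε : 0 < ε)
    (h : ∀ m n, m < n → ∀ x ∈ E m, ∀ y ∈ E n, ε ≤ dist x y) (p : X) :
    ∃ W : Set X, IsOpen W ∧ p ∈ W ∧ (⋃ n, E n) ∩ W ⊆ {p} := by
  have hfin : ((⋃ n, E n) ∩ Metric.ball p (ε / 2)).Finite := by
    rcases eq_empty_or_nonempty ((⋃ n, E n) ∩ Metric.ball p (ε / 2)) with h0 | ⟨q, hq, hqp⟩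
    · rw [h0]; exact finite_empty
    obtain ⟨n, hn⟩ := mem_iUnion.1 hq
    refine (hE n).subset ?_
    rintro x ⟨hx, hxp⟩
    obtain ⟨m, hm⟩ := mem_iUnion.1 hx
    have hxq : dist x q < ε := by
      have := dist_triangle_right x q p
      rw [Metric.mem_ball] at hxp hqp
      linarith
    rcases lt_trichotomy m n with hmn | rfl | hmn
    · exact absurd (h m n hmn x hm q hn) (not_le.2 hxq)
    · exact hm
    · rw [dist_comm] at hxq
      exact absurd (h n m hmn q hn x hm) (not_le.2 hxq)
  refine ⟨Metric.ball p (ε / 2) \ (((⋃ n, E n) ∩ Metric.ball p (ε / 2)) \ {p}),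
    Metric.isOpen_ball.sdiff hfin.sdiff.isClosed,
    ⟨Metric.mem_ball_self (by linarith), fun hp => hp.2 rfl⟩, ?_⟩
  rintro x ⟨hx, hxb, hxn⟩
  by_contra hxp
  exact hxn ⟨⟨hx, hxb⟩, hxp⟩

theorem IsThin.exists_finset_meetsConnectors {X : Type*} [MetricSpace X] (hthin : IsThin X)
    {A B N : Set X} (hA : IsConnected A) (hB : IsConnected B) (hN : IsOpen N)
    (hNAB : Disjoint N (A ∪ B)) (hmeet : MeetsConnectors N A B) {ε : ℝ} (hε : 0 < ε) :
    ∃ F : Finset X, MeetsConnectors (N ∩ ⋃ x ∈ F, Metric.ball x ε) A B := by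
  classical
  by_contra! hF
  have hchain : ∀ (F : Finset X) (n : ℕ), ∃ E : Finset X,
      (∀ x ∈ F, ∀ y ∈ E, y ∈ N → ε ≤ dist x y) ∧ ∃ a ∈ A, ∃ b ∈ B, ∀ U : Set X, a ∈ U →
        (∀ u ∈ U, ∀ v ∈ E, dist u v < 1 / ((n : ℝ) + 1) → v ∈ U) → b ∈ U := by
    intro F n
    have hFF := hF F
    simp only [MeetsConnectors, not_forall] at hFF
    obtain ⟨C, -, hC, ⟨a, haC, haA⟩, ⟨b, hbC, hbB⟩, hCN⟩ := hFF
    obtain ⟨E, hE, h⟩ := hC.isPreconnected.exists_finset_chain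
      (Nat.one_div_pos_of_nat (α := ℝ) (n := n)) haC hbC
    refine ⟨E, fun x hx y hy hyN => ?_, a, haA, b, hbB, h⟩
    by_contra! hxy
    refine hCN ⟨y, ⟨hyN, mem_biUnion hx ?_⟩, hE hy⟩
    rwa [Metric.mem_ball, dist_comm]
  choose e hefar he using hchain
  let G : ℕ → Finset X := fun n => Nat.rec ∅ (fun n F => F ∪ e F n) n
  have hG : ∀ n, G (n + 1) = G n ∪ e (G n) n := fun n => rfl
  have hGmono : Monotone G := monotone_nat_of_le_succ fun n => by
    rw [hG]; exact Finset.subset_union_left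
  have hsub : ∀ m n, m < n → e (G m) m ⊆ G n := fun m n hmn =>
    (Finset.subset_union_right.trans (hG m).ge).trans (hGmono hmn)
  let D : Set X := ⋃ n, (e (G n) n : Set X) ∩ N
  have hD : ∀ p, ∃ W : Set X, IsOpen W ∧ p ∈ W ∧ D ∩ W ⊆ {p} :=
    exists_isOpen_inter_iUnion_subset_singleton
      (fun n => (e (G n) n).finite_toSet.inter_of_left N) hε
      fun m n hmn x hx y hy => hefar (G n) n x (hsub m n hmn hx.1) y hy.1 hy.2
  have hY : IsClosed (Nᶜ ∪ D) := by
    rw [← isOpen_compl_iff, isOpen_iff_forall_mem_open]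
    intro p hp
    rw [compl_union, compl_compl] at hp ⊢
    obtain ⟨W, hW, hpW, hWD⟩ := hD p
    refine ⟨N ∩ W, fun x hx => ⟨hx.1, fun hxD => hp.2 ?_⟩, hN.inter hW, hp.1, hpW⟩
    have : x = p := hWD ⟨hxD, hx.2⟩
    exact this ▸ hxD
  have hAN : A ⊆ Nᶜ := fun x hx hxN => disjoint_left.1 hNAB hxN (Or.inl hx)
  have hBN : B ⊆ Nᶜ := fun x hx hxN => disjoint_left.1 hNAB hxN (Or.inr hx)
  have heY : ∀ n, ∀ v ∈ e (G n) n, v ∈ Nᶜ ∪ D := fun n v hv => by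
    by_cases hvN : v ∈ N
    · exact Or.inr (mem_iUnion.2 ⟨n, hv, hvN⟩)
    · exact Or.inl hvN
  obtain ⟨a, ha⟩ := hA.nonempty
  obtain ⟨b, hb⟩ := hB.nonempty
  have haY : a ∈ Nᶜ ∪ D := Or.inl (hAN ha)
  have hbQ : b ∈ uniformQuasiComponent (Nᶜ ∪ D) a := by
    rintro U ⟨-, haU, η, hη, hU⟩
    have hAU := hA.isPreconnected.subset_of_gap (hAN.trans subset_union_left) hη hU ⟨a, ha, haU⟩
    obtain ⟨n, hn⟩ := exists_nat_one_div_lt hη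
    obtain ⟨a', ha', b', hb', h⟩ := he (G n) n
    refine hB.isPreconnected.subset_of_gap (hBN.trans subset_union_left) hη hU
      ⟨b', hb', h U (hAU ha') fun u hu v hv huv => ?_⟩ hb
    by_contra hvU
    exact absurd (hU u hu v ⟨heY n v hv, hvU⟩) (not_le.2 (huv.trans hn))
  have hQ := hthin _ hY a haY
  have haQ := mem_uniformQuasiComponent_self (Nᶜ ∪ D) a
  obtain ⟨p, hpN, hpQ⟩ := hmeet _ (isClosed_uniformQuasiComponent hY a) hQ ⟨a, haQ, ha⟩
    ⟨b, hbQ, hb⟩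
  obtain ⟨W, hW, hpW, hWD⟩ := hD p
  have hap : a = p := by
    refine eq_of_isPreconnected_of_isolated hQ.isPreconnected hpQ haQ (hW.inter hN) ⟨hpW, hpN⟩ ?_
    rintro x ⟨hxQ, hxW, hxN⟩
    rcases uniformQuasiComponent_subset haY hxQ with hx | hx
    · exact absurd hxN hx
    · exact hWD ⟨hx, hxW⟩
  exact hAN ha (hap ▸ hpN)

theorem exists_isOpen_meetsConnectors {X : Type*} [MetricSpace X] {A B : Set X}
    (hA : IsClosed A) (hB : IsClosed B) (hAn : A.Nonempty) (hBn : B.Nonempty)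
    (hAB : Disjoint A B) :
    ∃ N : Set X, IsOpen N ∧ Disjoint (closure N) (A ∪ B) ∧ MeetsConnectors N A B := by
  have hcA := Metric.continuous_infDist_pt A
  have hcB := Metric.continuous_infDist_pt B
  refine ⟨{x | Metric.infDist x A < 2 * Metric.infDist x B} ∩
    {x | Metric.infDist x B < 2 * Metric.infDist x A},
    (isOpen_lt hcA (hcB.const_mul 2)).inter (isOpen_lt hcB (hcA.const_mul 2)), ?_, ?_⟩
  · refine disjoint_left.2 fun x hx => ?_
    have h1 : Metric.infDist x A ≤ 2 * Metric.infDist x B :=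
      closure_lt_subset_le hcA (hcB.const_mul 2) (closure_mono inter_subset_left hx)
    have h2 : Metric.infDist x B ≤ 2 * Metric.infDist x A :=
      closure_lt_subset_le hcB (hcA.const_mul 2) (closure_mono inter_subset_right hx)
    rintro (hxA | hxB)
    · rw [Metric.infDist_zero_of_mem hxA] at h2
      exact disjoint_left.1 hAB hxA ((hB.mem_iff_infDist_zero hBn).2
        (le_antisymm (by linarith) Metric.infDist_nonneg))
    · rw [Metric.infDist_zero_of_mem hxB] at h1
      exact disjoint_left.1 hAB ((hA.mem_iff_infDist_zero hAn).2
        (le_antisymm (by linarith) Metric.infDist_nonneg)) hxB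
  · rintro C - hC ⟨a, haC, haA⟩ ⟨b, hbC, hbB⟩
    obtain ⟨x, hxC, hx⟩ := hC.isPreconnected.intermediate_value₂ haC hbC hcA.continuousOn
      hcB.continuousOn (by rw [Metric.infDist_zero_of_mem haA]; exact Metric.infDist_nonneg)
      (by rw [Metric.infDist_zero_of_mem hbB]; exact Metric.infDist_nonneg)
    have hpos : 0 < Metric.infDist x A := by
      refine lt_of_le_of_ne Metric.infDist_nonneg fun h0 => ?_
      exact disjoint_left.1 hAB ((hA.mem_iff_infDist_zero hAn).2 h0.symm)
        ((hB.mem_iff_infDist_zero hBn).2 (hx ▸ h0.symm))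
    refine ⟨x, ⟨?_, ?_⟩, hxC⟩ <;> simp only [mem_ofPred_eq] <;> linarith

/-- In a complete space, a decreasing sequence of nonempty sets with finite covers by balls of
radius tending to zero has a compact intersection of closures, met by every closed set which
meets all terms of the sequence. -/
theorem isCompact_iInter_closure_of_covers {X : Type*} [MetricSpace X] [CompleteSpace X]
    {N : ℕ → Set X} (hN : Antitone N)
    (hcov : ∀ n, ∃ F : Finset X, N (n + 1) ⊆ ⋃ x ∈ F, Metric.ball x (1 / ((n : ℝ) + 1))) :
    IsCompact (⋂ n, closure (N n)) ∧
      ∀ C : Set X, IsClosed C → (∀ n, (N n ∩ C).Nonempty) → ((⋂ n, closure (N n)) ∩ C).Nonempty := by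
  constructor
  · refine TotallyBounded.isCompact_of_isClosed ?_ (isClosed_iInter fun _ => isClosed_closure)
    refine Metric.totallyBounded_iff.2 fun ε hε => ?_
    obtain ⟨n, hn⟩ := exists_nat_one_div_lt hε
    obtain ⟨F, hF⟩ := hcov n
    refine ⟨F, F.finite_toSet, ?_⟩
    have hcl : closure (N (n + 1)) ⊆ ⋃ x ∈ F, Metric.closedBall x (1 / ((n : ℝ) + 1)) :=
      closure_minimal (hF.trans (iUnion₂_mono fun x _ => Metric.ball_subset_closedBall))
        (F.finite_toSet.isClosed_biUnion fun _ _ => Metric.isClosed_closedBall)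
    exact (iInter_subset _ (n + 1)).trans
      (hcl.trans (iUnion₂_mono fun x _ => Metric.closedBall_subset_ball hn))
  · intro C hC hmeet
    choose c hcN hcC using hmeet
    have htb : TotallyBounded (range c) := by
      refine Metric.totallyBounded_iff.2 fun ε hε => ?_
      obtain ⟨n, hn⟩ := exists_nat_one_div_lt hε
      obtain ⟨F, hF⟩ := hcov n
      refine ⟨F ∪ c '' Iic n, F.finite_toSet.union ((finite_Iic n).image c), ?_⟩
      rintro _ ⟨m, rfl⟩
      by_cases hm : m ≤ n
      · exact mem_biUnion (Or.inr ⟨m, hm, rfl⟩) (Metric.mem_ball_self hε)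
      · obtain ⟨x, hx, hxm⟩ := mem_iUnion₂.1 (hF (hN (by omega : n + 1 ≤ m) (hcN m)))
        exact mem_biUnion (Or.inl hx) (Metric.ball_subset_ball hn.le hxm)
    have hcomp : IsCompact (closure (range c)) :=
      htb.closure.isCompact_of_isClosed isClosed_closure
    obtain ⟨x, -, φ, hφ, hlim⟩ := hcomp.tendsto_subseq fun n => subset_closure (mem_range_self n)
    refine ⟨x, mem_iInter.2 fun n => mem_closure_of_tendsto hlim ?_,
      hC.mem_of_tendsto hlim (Eventually.of_forall fun n => hcC _)⟩
    filter_upwards [eventually_ge_atTop n] with m hm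
    exact hN (hm.trans (hφ.id_le m)) (hcN _)

theorem IsThin.exists_isCompact_meetsConnectors {X : Type*} [MetricSpace X] [CompleteSpace X]
    (hthin : IsThin X) {A B : Set X} (hA : IsClosed A) (hB : IsClosed B)
    (hAc : IsConnected A) (hBc : IsConnected B) (hAB : Disjoint A B) :
    ∃ K : Set X, IsCompact K ∧ Disjoint K (A ∪ B) ∧ MeetsConnectors K A B := by
  obtain ⟨N₀, hN₀, hN₀AB, hmeet₀⟩ :=
    exists_isOpen_meetsConnectors hA hB hAc.nonempty hBc.nonempty hAB
  let T := {N : Set X // IsOpen N ∧ Disjoint N (A ∪ B) ∧ MeetsConnectors N A B}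
  have hstep : ∀ (M : T) (n : ℕ), ∃ M' : T, M'.1 ⊆ M.1 ∧
      ∃ F : Finset X, M'.1 ⊆ ⋃ x ∈ F, Metric.ball x (1 / ((n : ℝ) + 1)) := by
    rintro ⟨M, hM, hMAB, hMmeet⟩ n
    obtain ⟨F, hF⟩ := hthin.exists_finset_meetsConnectors hAc hBc hM hMAB hMmeet
      (Nat.one_div_pos_of_nat (α := ℝ) (n := n))
    exact ⟨⟨_, hM.inter (isOpen_biUnion fun _ _ => Metric.isOpen_ball),
      hMAB.mono_left inter_subset_left, hF⟩, inter_subset_left, F, inter_subset_right⟩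
  choose next hnext hcov using hstep
  let N : ℕ → T := fun n =>
    Nat.rec ⟨N₀, hN₀, hN₀AB.mono_left subset_closure, hmeet₀⟩ (fun n M => next M n) n
  obtain ⟨hK, hKC⟩ := isCompact_iInter_closure_of_covers (N := fun n => (N n).1)
    (antitone_nat_of_succ_le fun n => hnext (N n) n) fun n => hcov (N n) n
  exact ⟨_, hK, hN₀AB.mono_left (iInter_subset _ 0), fun C hC hCc hCA hCB =>
    hKC C hC fun n => (N n).2.2.2 C hC hCc hCA hCB⟩

theorem SeparatesSets.mono {X : Type*} [TopologicalSpace X] {S T A B : Set X}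
    (h : SeparatesSets S A B) (hST : S ⊆ T) (hT : Disjoint T (A ∪ B)) : SeparatesSets T A B := by
  obtain ⟨P, Q, hPQ, hdisj, ⟨h1, h2⟩, hAP, hBQ⟩ := h
  refine ⟨P \ T, Q \ T, ?_, hdisj.mono sdiff_subset sdiff_subset,
    ⟨subset_eq_empty (inter_subset_inter (closure_mono sdiff_subset) sdiff_subset) h1,
      subset_eq_empty (inter_subset_inter sdiff_subset (closure_mono sdiff_subset)) h2⟩,
    fun x hx => ⟨hAP hx, fun hxT => disjoint_left.1 hT hxT (Or.inl hx)⟩,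
    fun x hx => ⟨hBQ hx, fun hxT => disjoint_left.1 hT hxT (Or.inr hx)⟩⟩
  rw [← union_sdiff_distrib, hPQ, sdiff_eq, inter_eq_right]
  exact compl_subset_compl.2 hST

/-- Let `X` be a complete thin metric space and `A`, `B` disjoint closed connected
subsets. Then (1) there is a compact `K` such that every open `V ⊇ K` disjoint from
`A ∪ B` separates `A` and `B`; (2) this `K` meets every closed connected set meeting
both `A` and `B`; (3) if `X` is locally compact, some compact `K'` separates `A`
and `B`. -/
theorem stmt13 {X : Type*} [MetricSpace X] [CompleteSpace X] (hthin : IsThin X)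
    (A B : Set X) (hA : IsClosed A) (hB : IsClosed B)
    (hAc : IsConnected A) (hBc : IsConnected B) (hAB : Disjoint A B) :
    (∃ K : Set X, IsCompact K ∧
      (∀ V : Set X, IsOpen V → K ⊆ V → Disjoint V (A ∪ B) → SeparatesSets V A B) ∧
      (∀ C : Set X, IsClosed C → IsConnected C → (C ∩ A).Nonempty → (C ∩ B).Nonempty →
        (K ∩ C).Nonempty)) ∧
    (LocallyCompactSpace X →
      ∃ K' : Set X, IsCompact K' ∧ SeparatesSets K' A B) := by
  obtain ⟨K, hK, hKAB, hmeet⟩ := hthin.exists_isCompact_meetsConnectors hA hB hAc hBc hAB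
  have hsep : ∀ V : Set X, IsOpen V → K ⊆ V → Disjoint V (A ∪ B) → SeparatesSets V A B :=
    fun V hV hKV hVAB => hthin.separatesSets_of_meetsConnectors hAc hBc hmeet hV hKV hVAB
  refine ⟨⟨K, hK, hsep, hmeet⟩, fun _ => ?_⟩
  obtain ⟨V, hV, hKV, hVAB, hVc⟩ := exists_open_between_and_isCompact_closure hK
    (hA.union hB).isOpen_compl (subset_compl_iff_disjoint_right.2 hKAB)
  have hdisj : Disjoint (closure V) (A ∪ B) := subset_compl_iff_disjoint_right.1 hVAB
  exact ⟨closure V, hVc, (hsep V hV hKV (hdisj.mono_left subset_closure)).mono subset_closure hdisj⟩
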